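/- arXiv:math/0611935 — 3 statements merged into one kernel-verified Lean document; each statement's English description precedes it below -/
import Mathlib

section
/- Let A be the generator of a C₀-semigroup (e^{tA})_{t≥0} on a complex Banach space X. Then the following are equivalent: (i) A is a bounded operator (equivalently, dom A = X); (ii) for every bounded projection P on X, every x ∈ X and every t ≥ 0, the limit lim_{n→∞} (e^{(t/n)A} P)^n x exists in X. -/
open Filter Topology

/-- A C₀-semigroup on a complex normed space `X`: a strongly continuous map
`T : [0,∞) → B(X)` with `T 0 = I` and `T (s+t) = T s ∘ T t`. -/
structure C0Semigroup (X : Type*) [NormedAddCommGroup X] [NormedSpace ℂ X] where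
  T : ℝ → X →L[ℂ] X
  T_zero : T 0 = 1
  T_add : ∀ s t : ℝ, 0 ≤ s → 0 ≤ t → T (s + t) = (T s).comp (T t)
  T_cont : ∀ x : X, ContinuousOn (fun t => T t x) (Set.Ici (0 : ℝ))

/-- `A`, with domain `domA`, is the generator of the C₀-semigroup `Sg`:
`domA` is exactly the set of `x ∈ X` for which `(T t x - x)/t` converges as
`t → 0⁺`, and `A x` is this limit. -/
def IsGeneratorOf {X : Type*} [NormedAddCommGroup X] [NormedSpace ℂ X]
    (Sg : C0Semigroup X) (domA : Set X) (A : X → X) : Prop :=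
  (∀ x : X, x ∈ domA ↔
      ∃ y : X, Tendsto (fun t : ℝ => t⁻¹ • (Sg.T t x - x)) (𝓝[>] 0) (𝓝 y)) ∧
  (∀ x ∈ domA, Tendsto (fun t : ℝ => t⁻¹ • (Sg.T t x - x)) (𝓝[>] 0) (𝓝 (A x)))

section Helpers

lemma norm_pow_sub_pow_le_aux {R : Type*} [NormedRing R] [NormOneClass R] (a b : R) (M : ℝ)
    (hM : 1 ≤ M) (ha : ‖a‖ ≤ M) (hb : ‖b‖ ≤ M) (k : ℕ) :
    ‖a ^ k - b ^ k‖ ≤ k * M ^ k * ‖a - b‖ := by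
  induction k with
  | zero => simp
  | succ k ih =>
    have e : a ^ (k + 1) - b ^ (k + 1) = a ^ k * (a - b) + (a ^ k - b ^ k) * b := by
      rw [pow_succ, pow_succ]; noncomm_ring
    rw [e]
    have hM0 : 0 ≤ M := by linarith
    have h1 : ‖a ^ k * (a - b)‖ ≤ M ^ (k + 1) * ‖a - b‖ := by
      refine (norm_mul_le _ _).trans ?_
      gcongr
      refine (norm_pow_le a k).trans ?_
      refine (pow_le_pow_left₀ (norm_nonneg _) ha k).trans ?_
      exact pow_le_pow_right₀ hM (Nat.le_succ k)
    have h2 : ‖(a ^ k - b ^ k) * b‖ ≤ (k * M ^ k * ‖a - b‖) * M := by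
      refine (norm_mul_le _ _).trans ?_
      gcongr
    calc _ ≤ _ := norm_add_le _ _
      _ ≤ _ := add_le_add h1 h2
      _ = _ := by push_cast; ring

lemma chernoff_aux {R : Type*} [NormedRing R] [NormOneClass R] [NormedAlgebra ℝ R]
    [CompleteSpace R] (a : ℕ → R) (L : R)
    (ha : Tendsto (fun n : ℕ => ((n : ℝ) + 1) • (a n - 1)) atTop (𝓝 L)) :
    Tendsto (fun n : ℕ => a n ^ n) atTop (𝓝 (NormedSpace.exp L)) := by
  let _ : NormedAlgebra ℚ R := NormedAlgebra.restrictScalars ℚ ℝ R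
  set b : ℕ → R := fun n => NormedSpace.exp (((n : ℝ) + 1)⁻¹ • L) with hbdef
  have hinv : Tendsto (fun n : ℕ => ((n : ℝ) + 1)⁻¹) atTop (𝓝[≠] 0) := by
    refine tendsto_nhdsWithin_iff.2 ⟨?_, ?_⟩
    · simpa using tendsto_one_div_add_atTop_nhds_zero_nat (𝕜 := ℝ)
    · filter_upwards with n
      have : (0 : ℝ) < (n : ℝ) + 1 := by positivity
      exact (inv_pos.2 this).ne'
  have hb : Tendsto (fun n : ℕ => ((n : ℝ) + 1) • (b n - 1)) atTop (𝓝 L) := by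
    have h := hasDerivAt_exp_smul_const (𝕂 := ℝ) L 0
    rw [hasDerivAt_iff_tendsto_slope_zero] at h
    have h2 := h.comp hinv
    simpa [Function.comp_def, b] using h2
  have hbpow : Tendsto (fun n : ℕ => b n ^ n) atTop (𝓝 (NormedSpace.exp L)) := by
    have e : ∀ n : ℕ, b n ^ n = NormedSpace.exp (((n : ℝ) / ((n : ℝ) + 1)) • L) := by
      intro n
      simp only [b]
      rw [← NormedSpace.exp_nsmul, ← Nat.cast_smul_eq_nsmul ℝ, smul_smul]
      rfl
    simp_rw [e]
    have h1 : Tendsto (fun n : ℕ => ((n : ℝ) / ((n : ℝ) + 1))) atTop (𝓝 1) :=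
      tendsto_natCast_div_add_atTop 1
    have h2 : Tendsto (fun n : ℕ => ((n : ℝ) / ((n : ℝ) + 1)) • L) atTop (𝓝 L) := by
      simpa using h1.smul_const L
    exact (NormedSpace.exp_continuous.tendsto L).comp h2
  have hC : ∀ᶠ n : ℕ in atTop, ‖((n : ℝ) + 1) • (a n - 1)‖ ≤ ‖L‖ + 1 :=
    (ha.norm.eventually (gt_mem_nhds (lt_add_one ‖L‖))).mono fun _ h => le_of_lt h
  have hC' : ∀ᶠ n : ℕ in atTop, ‖((n : ℝ) + 1) • (b n - 1)‖ ≤ ‖L‖ + 1 :=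
    (hb.norm.eventually (gt_mem_nhds (lt_add_one ‖L‖))).mono fun _ h => le_of_lt h
  have hdiff : Tendsto (fun n : ℕ => Real.exp (‖L‖ + 1) * ‖((n : ℝ) + 1) • (a n - b n)‖)
      atTop (𝓝 0) := by
    have h := ((ha.sub hb).norm).const_mul (Real.exp (‖L‖ + 1))
    simp only [sub_self, norm_zero, mul_zero] at h
    refine h.congr fun n => ?_
    rw [← smul_sub]; simp
  have hz : Tendsto (fun n : ℕ => a n ^ n - b n ^ n) atTop (𝓝 0) := by
    refine squeeze_zero_norm' ?_ hdiff
    filter_upwards [hC, hC'] with n h1 h2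
    have hn : (0 : ℝ) < (n : ℝ) + 1 := by positivity
    set C := ‖L‖ + 1
    have hC0 : 0 ≤ C := by positivity
    have key : ∀ c : R, ‖((n : ℝ) + 1) • (c - 1)‖ ≤ C → ‖c‖ ≤ 1 + C / (n + 1) := by
      intro c hc
      rw [norm_smul, Real.norm_of_nonneg hn.le, mul_comm, ← le_div_iff₀ hn] at hc
      calc ‖c‖ = ‖1 + (c - 1)‖ := by simp
        _ ≤ ‖(1 : R)‖ + ‖c - 1‖ := norm_add_le _ _
        _ ≤ _ := by rw [norm_one]; linarith
    have h3 := norm_pow_sub_pow_le_aux (a n) (b n) (1 + C / (n + 1))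
      (by have : 0 ≤ C / ((n : ℝ) + 1) := by positivity
          linarith) (key _ h1) (key _ h2) n
    have h4 : (1 + C / ((n : ℝ) + 1)) ^ n ≤ Real.exp C := by
      have : 1 + C / ((n : ℝ) + 1) ≤ Real.exp (C / (n + 1)) := by
        have := Real.add_one_le_exp (C / ((n : ℝ) + 1)); linarith
      refine (pow_le_pow_left₀ (by positivity) this n).trans ?_
      rw [← Real.exp_nat_mul]
      apply Real.exp_le_exp.2
      rw [mul_div_assoc', div_le_iff₀ hn]
      nlinarith
    refine h3.trans ?_
    rw [norm_smul, Real.norm_of_nonneg hn.le]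
    calc (n : ℝ) * (1 + C / (n + 1)) ^ n * ‖a n - b n‖
        ≤ (n + 1) * Real.exp C * ‖a n - b n‖ := by gcongr; linarith
      _ = _ := by ring
  simpa using hz.add hbpow

variable {X : Type*} [NormedAddCommGroup X] [NormedSpace ℂ X] [CompleteSpace X]

lemma sg_eq_exp (Sg : C0Semigroup X) (A : X →L[ℂ] X)
    (hA : ∀ x, Tendsto (fun t : ℝ => t⁻¹ • (Sg.T t x - x)) (𝓝[>] 0) (𝓝 (A x)))
    (t : ℝ) (ht : 0 ≤ t) : Sg.T t = NormedSpace.exp (t • A) := by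
  ext x
  have hg : ∀ s : ℝ, HasDerivAt (fun s : ℝ => NormedSpace.exp (s • A) x)
      (A (NormedSpace.exp (s • A) x)) s := by
    intro s
    have h := hasDerivAt_exp_smul_const' (𝕂 := ℝ) A s
    exact ((ContinuousLinearMap.apply ℂ X x).restrictScalars ℝ).hasFDerivAt.comp_hasDerivAt s h
  have := ODE_solution_unique (v := fun _ : ℝ => (A : X → X)) (K := ‖A‖₊)
    (f := fun s => Sg.T s x) (g := fun s => NormedSpace.exp (s • A) x) (a := 0) (b := t)
    (fun _ => A.lipschitz) ((Sg.T_cont x).mono Set.Icc_subset_Ici_self) ?_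
    (fun s _ => (hg s).continuousAt.continuousWithinAt) (fun s _ => (hg s).hasDerivWithinAt) ?_
  · exact this (Set.right_mem_Icc.2 ht)
  · intro s hs
    rw [← hasDerivWithinAt_Ioi_iff_Ici, hasDerivWithinAt_iff_tendsto_slope' (by simp)]
    have hsub : Tendsto (fun r : ℝ => r - s) (𝓝[>] s) (𝓝[>] 0) := by
      refine tendsto_nhdsWithin_iff.2 ⟨?_, ?_⟩
      · have : Tendsto (fun r : ℝ => r - s) (𝓝 s) (𝓝 (s - s)) := tendsto_id.sub_const s
        rw [sub_self] at this
        exact this.mono_left nhdsWithin_le_nhds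
      · filter_upwards [self_mem_nhdsWithin] with r hr
        exact sub_pos.2 (Set.mem_Ioi.1 hr)
    refine ((hA (Sg.T s x)).comp hsub).congr' ?_
    filter_upwards [self_mem_nhdsWithin] with r hr
    have hr' : 0 ≤ r - s := (sub_pos.2 (Set.mem_Ioi.1 hr)).le
    have e := Sg.T_add (r - s) s hr' hs.1
    rw [sub_add_cancel] at e
    simp [slope_def_module, e]
  · simp [Sg.T_zero]



lemma forward_dir (Sg : C0Semigroup X) (A : X →L[ℂ] X)
    (hA : ∀ x, Tendsto (fun t : ℝ => t⁻¹ • (Sg.T t x - x)) (𝓝[>] 0) (𝓝 (A x)))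
    (P : X →L[ℂ] X) (hP : P * P = P) (x : X) (t : ℝ) (ht : 0 ≤ t) :
    ∃ y : X, Tendsto (fun n : ℕ => (((Sg.T (t / n)).comp P) ^ n) x) atTop (𝓝 y) := by
  rcases subsingleton_or_nontrivial X with hX | hX
  · refine ⟨0, ?_⟩
    rw [show (fun n : ℕ => (((Sg.T (t / n)).comp P) ^ n) x) = fun _ => 0 from
      funext fun _ => Subsingleton.elim _ _]
    exact tendsto_const_nhds
  set E : ℕ → X →L[ℂ] X := fun n => NormedSpace.exp (((n : ℝ) + 1)⁻¹ • (t • A)) with hE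
  have hinv : Tendsto (fun n : ℕ => ((n : ℝ) + 1)⁻¹) atTop (𝓝[≠] 0) := by
    refine tendsto_nhdsWithin_iff.2 ⟨?_, ?_⟩
    · simpa using tendsto_one_div_add_atTop_nhds_zero_nat (𝕜 := ℝ)
    · filter_upwards with n
      have : (0 : ℝ) < (n : ℝ) + 1 := by positivity
      exact (inv_pos.2 this).ne'
  have hd : HasDerivAt (fun u : ℝ => NormedSpace.exp (u • (t • A))) (t • A) 0 := by
    simpa using hasDerivAt_exp_smul_const (𝕂 := ℝ) (t • A) 0
  have hb : Tendsto (fun n : ℕ => ((n : ℝ) + 1) • (E n - 1)) atTop (𝓝 (t • A)) := by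
    have h := hd
    rw [hasDerivAt_iff_tendsto_slope_zero] at h
    have h2 := h.comp hinv
    simpa [Function.comp_def, E] using h2
  have hE1 : Tendsto E atTop (𝓝 1) := by
    have h := hd.continuousAt.tendsto.comp (hinv.mono_right nhdsWithin_le_nhds)
    simpa [Function.comp_def, E] using h
  have hG : Tendsto (fun n : ℕ => ((n : ℝ) + 1) • ((1 + P * (E n - 1) * P) - 1)) atTop
      (𝓝 (P * (t • A) * P)) := by
    refine ((hb.const_mul P).mul_const P).congr fun n => ?_
    simp
  have hlim := chernoff_aux _ _ hG
  have hpow : ∀ n k : ℕ, (E n * P) ^ (k + 1) = E n * P * (1 + P * (E n - 1) * P) ^ k := by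
    intro n k
    induction k with
    | zero => simp
    | succ k ih =>
      have key : E n * P * (E n * P) = E n * P * (1 + P * (E n - 1) * P) := by
        calc E n * P * (E n * P) = E n * P + E n * P * E n * P - E n * P := by noncomm_ring
          _ = E n * P + E n * (P * P) * E n * P - E n * (P * P) * P := by simp only [hP, mul_assoc]
          _ = _ := by noncomm_ring
      rw [pow_succ', ih, pow_succ' (1 + _), ← mul_assoc, key, mul_assoc]
  have hfin := (hE1.mul_const P).mul hlim
  refine ⟨(1 * P * NormedSpace.exp (P * (t • A) * P)) x, (tendsto_add_atTop_iff_nat 1).1 ?_⟩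
  have h2 := ((ContinuousLinearMap.apply ℂ X x).continuous.tendsto _).comp hfin
  refine h2.congr fun n => ?_
  simp only [Function.comp, ContinuousLinearMap.apply_apply]
  rw [← hpow]
  have : E n = Sg.T (t / ((n + 1 : ℕ) : ℝ)) := by
    rw [sg_eq_exp Sg A hA _ (by positivity)]
    simp only [E, smul_smul]
    congr 2
    push_cast
    rw [div_eq_inv_mul]
  rw [this]
  rfl

lemma dom_dense (Sg : C0Semigroup X) :
    Dense {x : X | ∃ y : X, Tendsto (fun t : ℝ => t⁻¹ • (Sg.T t x - x)) (𝓝[>] 0) (𝓝 y)} := by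
  intro x
  set u : ℝ → X := fun s => Sg.T |s| x with hu
  have huc : Continuous u := by
    have := (Sg.T_cont x).comp_continuous continuous_abs (fun s => abs_nonneg s)
    exact this
  have hint : ∀ a b : ℝ, IntervalIntegrable u MeasureTheory.volume a b :=
    fun a b => huc.intervalIntegrable a b
  set F : ℝ → X := fun t => ∫ s in (0 : ℝ)..t, u s with hF
  have hFd : ∀ t, HasDerivAt F (u t) t := fun t => huc.integral_hasStrictDerivAt 0 t |>.hasDerivAt
  have hF0 : F 0 = 0 := by simp [F]
  have hu0 : u 0 = x := by simp [u, Sg.T_zero]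
  have hlim : Tendsto (fun t : ℝ => t⁻¹ • F t) (𝓝[>] 0) (𝓝 x) := by
    have := (hFd 0).tendsto_slope_zero_right
    simpa [hF0, hu0] using this
  refine mem_closure_of_tendsto hlim ?_
  filter_upwards [self_mem_nhdsWithin] with t ht
  have ht0 : 0 < t := ht
  refine ⟨t⁻¹ • (u t - u 0), ?_⟩
  have h1 := (hFd t).tendsto_slope_zero_right
  have h2 := (hFd 0).tendsto_slope_zero_right
  refine ((h1.sub h2).const_smul t⁻¹).congr' ?_
  filter_upwards [self_mem_nhdsWithin] with h hh
  have hh0 : 0 < h := hh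
  have e1 : Sg.T h (F t) = F (t + h) - F h := by
    have : Sg.T h (F t) = ∫ s in (0 : ℝ)..t, u (s + h) := by
      simp only [F]
      rw [← ContinuousLinearMap.intervalIntegral_comp_comm _ (hint _ _)]
      refine intervalIntegral.integral_congr fun s hs => ?_
      rw [Set.uIcc_of_le ht0.le] at hs
      simp only [u]
      rw [abs_of_nonneg hs.1, abs_of_nonneg (by linarith [hs.1]), add_comm s h,
        Sg.T_add h s hh0.le hs.1]
      rfl
    rw [this, intervalIntegral.integral_comp_add_right, zero_add]
    simp only [F]
    rw [intervalIntegral.integral_interval_sub_left (hint _ _) (hint _ _)]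
  have e2 : Sg.T h (t⁻¹ • F t) = t⁻¹ • Sg.T h (F t) :=
    ((Sg.T h).restrictScalars ℝ).map_smul t⁻¹ (F t)
  rw [e2, e1, hF0, zero_add, sub_zero, ← smul_sub, ← smul_sub, smul_comm]
  congr 2
  abel

/-- The difference quotients along `1/(n+1)`. -/
noncomputable def Bq (Sg : C0Semigroup X) (n : ℕ) : X →L[ℂ] X :=
  ((n : ℂ) + 1) • (Sg.T (1 / ((n + 1 : ℕ) : ℝ)) - 1)

lemma re_bound (Sg : C0Semigroup X)
    (H : ∀ P : X →L[ℂ] X, P.comp P = P → ∀ (x : X) (t : ℝ), 0 ≤ t → ∃ y : X,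
            Tendsto (fun n : ℕ => (((Sg.T (t / n)).comp P) ^ n) x) atTop (𝓝 y))
    (f : X →L[ℂ] ℂ) (y : X) (hy : f y = 1) : ∃ C : ℝ, ∀ n, (f (Bq Sg n y)).re ≤ C := by
  set P : X →L[ℂ] X := f.smulRight y with hPdef
  obtain ⟨z, hz⟩ := H P (by ext v; simp [P, hy]) y 1 zero_le_one
  have hpow : ∀ (S : X →L[ℂ] X) (n : ℕ), f (((S.comp P) ^ n) y) = (f (S y)) ^ n := by
    intro S n
    induction n with
    | zero => simp [hy]
    | succ n ih =>
      have e : ((S.comp P) ^ (n + 1)) y = f (((S.comp P) ^ n) y) • S y := by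
        rw [pow_succ']
        change S (f (((S.comp P) ^ n) y) • y) = _
        rw [map_smul]
      rw [e, map_smul, ih, smul_eq_mul, pow_succ]
  have hb := ((f.continuous.tendsto z).comp hz).norm.bddAbove_range
  obtain ⟨K, hK⟩ := hb
  refine ⟨K, fun n => ?_⟩
  have h1 := hK ⟨n + 1, rfl⟩
  simp only [Function.comp, hpow, norm_pow] at h1
  set c := f (Sg.T (1 / ((n + 1 : ℕ) : ℝ)) y) with hc
  have h2 := one_add_mul_le_pow (a := ‖c‖ - 1) (by linarith [norm_nonneg c]) (n + 1)
  rw [add_sub_cancel] at h2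
  have e : f (Bq Sg n y) = (((n : ℝ) + 1 : ℝ) : ℂ) * (c - 1) := by
    simp [Bq, hc, hy]
  rw [e, Complex.re_ofReal_mul]
  have h3 := Complex.re_le_norm c
  simp only [Complex.sub_re, Complex.one_re]
  push_cast at h2
  have h4 : ((n : ℝ) + 1) * (c.re - 1) ≤ ((n : ℝ) + 1) * (‖c‖ - 1) := by gcongr
  linarith

lemma weak_bound (Sg : C0Semigroup X)
    (H : ∀ P : X →L[ℂ] X, P.comp P = P → ∀ (x : X) (t : ℝ), 0 ≤ t → ∃ y : X,
            Tendsto (fun n : ℕ => (((Sg.T (t / n)).comp P) ^ n) x) atTop (𝓝 y))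
    (f : X →L[ℂ] ℂ) (y : X) : ∃ C : ℝ, ∀ n, ‖f (Bq Sg n y)‖ ≤ C := by
  by_cases hf : f = 0
  · exact ⟨0, fun n => by simp [hf]⟩
  obtain ⟨w, hw⟩ : ∃ w, f w ≠ 0 := by
    by_contra! h
    exact hf (by ext v; simp [h v])
  obtain ⟨z0, hz0, ⟨d, hd⟩⟩ := (dom_dense Sg).inter_open_nonempty {v | f v ≠ 0}
    (isOpen_ne.preimage f.continuous) ⟨w, hw⟩
  have hinv : Tendsto (fun n : ℕ => 1 / ((n + 1 : ℕ) : ℝ)) atTop (𝓝[>] 0) := by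
    refine tendsto_nhdsWithin_iff.2 ⟨?_, ?_⟩
    · simpa using tendsto_one_div_add_atTop_nhds_zero_nat (𝕜 := ℝ)
    · filter_upwards with n
      exact Set.mem_Ioi.2 (by positivity)
  have hB0 : Tendsto (fun n => Bq Sg n z0) atTop (𝓝 d) := by
    refine (hd.comp hinv).congr fun n => ?_
    have e : (((n : ℝ) + 1 : ℝ) : ℂ) = (n : ℂ) + 1 := by push_cast; rfl
    have e2 : (1 / ((n + 1 : ℕ) : ℝ))⁻¹ = (n : ℝ) + 1 := by push_cast; simp
    simp only [Function.comp, Bq]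
    rw [e2, ← e]
    rfl
  set z : X := (f z0)⁻¹ • z0 with hz
  have hfz : f z = 1 := by
    simp only [hz, map_smul, smul_eq_mul]
    exact inv_mul_cancel₀ hz0
  obtain ⟨D, hD⟩ : ∃ D : ℝ, ∀ n, ‖f (Bq Sg n z)‖ ≤ D := by
    have h1 : Tendsto (fun n => f (Bq Sg n z)) atTop (𝓝 ((f z0)⁻¹ * f d)) := by
      have := ((f.continuous.tendsto d).comp hB0).const_mul (f z0)⁻¹
      refine this.congr fun n => by simp [hz]
    obtain ⟨D, hD⟩ := h1.norm.bddAbove_range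
    exact ⟨D, fun n => hD ⟨n, rfl⟩⟩
  have hker : ∀ v, f v = 0 → ∃ C : ℝ, ∀ n, (f (Bq Sg n v)).re ≤ C := by
    intro v hv
    obtain ⟨C, hC⟩ := re_bound Sg H f (z + v) (by simp [hfz, hv])
    refine ⟨C + D, fun n => ?_⟩
    have h1 := hC n
    have h2 := (abs_le.1 ((Complex.abs_re_le_norm _).trans (hD n))).1
    simp only [map_add, Complex.add_re] at h1
    linarith
  have hker2 : ∀ v, f v = 0 → ∃ C : ℝ, ∀ n, ‖f (Bq Sg n v)‖ ≤ C := by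
    intro v hv
    obtain ⟨C1, h1⟩ := hker v hv
    obtain ⟨C2, h2⟩ := hker (-v) (by simp [hv])
    obtain ⟨C3, h3⟩ := hker (Complex.I • v) (by simp [hv])
    obtain ⟨C4, h4⟩ := hker (-(Complex.I • v)) (by simp [hv])
    refine ⟨max C1 C2 + max C3 C4, fun n => ?_⟩
    have h1 := h1 n
    have h2 := h2 n
    have h3 := h3 n
    have h4 := h4 n
    simp only [map_neg, map_smul, Complex.neg_re, smul_eq_mul, Complex.I_mul_re, neg_neg]
      at h1 h2 h3 h4
    refine (Complex.norm_le_abs_re_add_abs_im _).trans (add_le_add ?_ ?_)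
    · exact abs_le.2 ⟨by linarith [le_max_right C1 C2], by linarith [le_max_left C1 C2]⟩
    · exact abs_le.2 ⟨by linarith [le_max_left C3 C4], by linarith [le_max_right C3 C4]⟩
  obtain ⟨C, hC⟩ := hker2 (y - f y • z) (by simp [hfz])
  refine ⟨C + ‖f y‖ * D, fun n => ?_⟩
  have e : f (Bq Sg n y) = f (Bq Sg n (y - f y • z)) + f y * f (Bq Sg n z) := by simp
  rw [e]
  refine (norm_add_le _ _).trans (add_le_add (hC n) ?_)
  rw [norm_mul]
  gcongr
  exact hD n

lemma Bq_bound (Sg : C0Semigroup X)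
    (H : ∀ P : X →L[ℂ] X, P.comp P = P → ∀ (x : X) (t : ℝ), 0 ≤ t → ∃ y : X,
            Tendsto (fun n : ℕ => (((Sg.T (t / n)).comp P) ^ n) x) atTop (𝓝 y)) :
    ∃ C : ℝ, ∀ n, ‖Bq Sg n‖ ≤ C := by
  refine banach_steinhaus fun y => ?_
  obtain ⟨C, hC⟩ := banach_steinhaus
    (g := fun n => NormedSpace.inclusionInDoubleDual ℂ X (Bq Sg n y))
    (fun f => by simpa using weak_bound Sg H f y)
  refine ⟨C, fun n => ?_⟩
  have := hC n
  rwa [show ‖NormedSpace.inclusionInDoubleDual ℂ X (Bq Sg n y)‖ = ‖Bq Sg n y‖ from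
    (NormedSpace.inclusionInDoubleDualLi ℂ (E := X)).norm_map _] at this

lemma lip_bound (Sg : C0Semigroup X) (C : ℝ) (hC : ∀ n, ‖Bq Sg n‖ ≤ C) :
    ∃ K : ℝ, 0 ≤ K ∧ ∀ t : ℝ, 0 ≤ t → t ≤ 1 → ∀ x, ‖Sg.T t x - x‖ ≤ K * t * ‖x‖ := by
  obtain ⟨M, hM⟩ := banach_steinhaus (g := fun s : Set.Icc (0 : ℝ) 1 => Sg.T s) (fun x => by
    have hc : ContinuousOn (fun t => Sg.T t x) (Set.Icc 0 1) :=
      (Sg.T_cont x).mono Set.Icc_subset_Ici_self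
    obtain ⟨M, hM⟩ := isCompact_Icc.exists_bound_of_continuousOn hc
    exact ⟨M, fun s => hM s s.2⟩)
  have hM0 : 0 ≤ M := (norm_nonneg _).trans (hM ⟨0, by simp⟩)
  have hC0 : 0 ≤ C := (norm_nonneg _).trans (hC 0)
  have hstep : ∀ n : ℕ, ‖Sg.T (1 / ((n + 1 : ℕ) : ℝ)) - 1‖ ≤ C / (n + 1) := by
    intro n
    have h := hC n
    have hn : (0 : ℝ) < (n : ℝ) + 1 := by positivity
    have e : (((n : ℝ) + 1 : ℝ) : ℂ) = (n : ℂ) + 1 := by push_cast; rfl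
    rw [Bq, norm_smul, ← e, Complex.norm_real, Real.norm_of_nonneg hn.le, mul_comm,
      ← le_div_iff₀ hn] at h
    exact h
  have hrat : ∀ n m : ℕ, m ≤ n + 1 →
      ‖Sg.T ((m : ℝ) / ((n + 1 : ℕ) : ℝ)) - 1‖ ≤ M * C * ((m : ℝ) / ((n + 1 : ℕ) : ℝ)) := by
    intro n m
    induction m with
    | zero => intro _; simp [Sg.T_zero]
    | succ m ih =>
      intro hm
      have ih := ih (by omega)
      have hnp : (0 : ℝ) < ((n + 1 : ℕ) : ℝ) := by positivity
      have e : Sg.T (((m + 1 : ℕ) : ℝ) / ((n + 1 : ℕ) : ℝ)) =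
          Sg.T ((m : ℝ) / ((n + 1 : ℕ) : ℝ)) * Sg.T (1 / ((n + 1 : ℕ) : ℝ)) := by
        rw [show (((m + 1 : ℕ) : ℝ) / ((n + 1 : ℕ) : ℝ)) =
          (m : ℝ) / ((n + 1 : ℕ) : ℝ) + 1 / ((n + 1 : ℕ) : ℝ) by push_cast; ring,
          Sg.T_add _ _ (by positivity) (by positivity)]
        rfl
      have hmem : (m : ℝ) / ((n + 1 : ℕ) : ℝ) ∈ Set.Icc (0 : ℝ) 1 := by
        refine ⟨by positivity, (div_le_one hnp).2 ?_⟩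
        exact_mod_cast (by omega : m ≤ n + 1)
      have hTm := hM ⟨_, hmem⟩
      set S := Sg.T ((m : ℝ) / ((n + 1 : ℕ) : ℝ))
      have e2 : S * Sg.T (1 / ((n + 1 : ℕ) : ℝ)) - 1
        = S * (Sg.T (1 / ((n + 1 : ℕ) : ℝ)) - 1) + (S - 1) := by noncomm_ring
      rw [e, e2]
      refine (norm_add_le _ _).trans ?_
      have h3 : ‖S * (Sg.T (1 / ((n + 1 : ℕ) : ℝ)) - 1)‖ ≤ M * (C / (n + 1)) :=
        (norm_mul_le _ _).trans (mul_le_mul hTm (hstep n) (norm_nonneg _) hM0)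
      refine (add_le_add h3 ih).trans (le_of_eq ?_)
      push_cast
      ring
  refine ⟨M * C, by positivity, fun t ht0 ht1 x => ?_⟩
  have hfl : Tendsto (fun n : ℕ => (⌊t * ((n + 1 : ℕ) : ℝ)⌋₊ : ℝ) / ((n + 1 : ℕ) : ℝ)) atTop
      (𝓝 t) := by
    have h1 : Tendsto (fun n : ℕ => ((n + 1 : ℕ) : ℝ)) atTop atTop :=
      (tendsto_natCast_atTop_atTop (R := ℝ)).comp (tendsto_add_atTop_nat 1)
    exact (tendsto_nat_floor_mul_div_atTop ht0).comp h1
  have hfl2 : Tendsto (fun n : ℕ => (⌊t * ((n + 1 : ℕ) : ℝ)⌋₊ : ℝ) / ((n + 1 : ℕ) : ℝ)) atTop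
      (𝓝[Set.Ici 0] t) :=
    tendsto_nhdsWithin_iff.2 ⟨hfl, Eventually.of_forall fun n => Set.mem_Ici.2 (by positivity)⟩
  have hl := (((Sg.T_cont x t ht0).tendsto.comp hfl2).sub_const x).norm
  have hr := (hfl.const_mul (M * C)).mul_const ‖x‖
  refine le_of_tendsto_of_tendsto' hl hr fun n => ?_
  have h := hrat n ⌊t * ((n + 1 : ℕ) : ℝ)⌋₊ (by
    refine Nat.floor_le_of_le ?_
    have : (0 : ℝ) ≤ ((n + 1 : ℕ) : ℝ) := by positivity
    nlinarith)
  exact ((Sg.T _ - 1).le_opNorm x).trans (by gcongr)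

lemma backward_dir (Sg : C0Semigroup X) (K : ℝ) (hK0 : 0 ≤ K)
    (hK : ∀ t : ℝ, 0 ≤ t → t ≤ 1 → ∀ x, ‖Sg.T t x - x‖ ≤ K * t * ‖x‖) (x : X) :
    ∃ y : X, Tendsto (fun t : ℝ => t⁻¹ • (Sg.T t x - x)) (𝓝[>] 0) (𝓝 y) ∧ ‖y‖ ≤ K * ‖x‖ := by
  have hq : ∀ t : ℝ, 0 < t → t ≤ 1 → ∀ x, ‖t⁻¹ • (Sg.T t x - x)‖ ≤ K * ‖x‖ := by
    intro t h0 h1 x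
    rw [norm_smul, norm_inv, Real.norm_of_nonneg h0.le, inv_mul_le_iff₀ h0]
    exact (hK t h0.le h1 x).trans (le_of_eq (by ring))
  have hI : Set.Ioc (0 : ℝ) 1 ∈ 𝓝[>] (0 : ℝ) := Ioc_mem_nhdsGT zero_lt_one
  have hex : ∃ y : X, Tendsto (fun t : ℝ => t⁻¹ • (Sg.T t x - x)) (𝓝[>] 0) (𝓝 y) := by
    refine cauchy_map_iff_exists_tendsto.1 (Metric.cauchy_iff.2 ⟨inferInstance, fun ε hε => ?_⟩)
    obtain ⟨w, ⟨d, hd⟩, hw⟩ := (dom_dense Sg).exists_dist_lt x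
      (show 0 < ε / (4 * (K + 1)) by positivity)
    have hw' : K * ‖x - w‖ < ε / 4 := by
      rw [dist_eq_norm, lt_div_iff₀ (by positivity)] at hw
      nlinarith [norm_nonneg (x - w)]
    have hev := hd.eventually (Metric.ball_mem_nhds d (show 0 < ε / 4 by positivity))
    have key : ∀ᶠ t in 𝓝[>] (0 : ℝ), dist (t⁻¹ • (Sg.T t x - x)) d < ε / 2 := by
      filter_upwards [hev, hI] with t h1 h2
      have h3 := hq t h2.1 h2.2 (x - w)
      rw [dist_eq_norm] at h1
      have e : t⁻¹ • (Sg.T t x - x) - d =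
          t⁻¹ • (Sg.T t (x - w) - (x - w)) + (t⁻¹ • (Sg.T t w - w) - d) := by
        rw [map_sub]; module
      rw [dist_eq_norm, e]
      linarith [norm_add_le (t⁻¹ • (Sg.T t (x - w) - (x - w))) (t⁻¹ • (Sg.T t w - w) - d)]
    refine ⟨_, image_mem_map key, ?_⟩
    rintro _ ⟨a, ha, rfl⟩ _ ⟨b, hb, rfl⟩
    have ha : dist (a⁻¹ • (Sg.T a x - x)) d < ε / 2 := ha
    have hb : dist (b⁻¹ • (Sg.T b x - x)) d < ε / 2 := hb
    linarith [dist_triangle_right (a⁻¹ • (Sg.T a x - x)) (b⁻¹ • (Sg.T b x - x)) d]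
  obtain ⟨y, hy⟩ := hex
  refine ⟨y, hy, le_of_tendsto hy.norm ?_⟩
  filter_upwards [hI] with t ht
  exact hq t ht.1 ht.2 x

end Helpers

/-- `A` (the generator) is bounded iff the Trotter-type products
`(e^{(t/n)A} P)^n x` converge for every bounded projection `P`, every `x` and `t ≥ 0`. -/
theorem stmt_0 {X : Type*} [NormedAddCommGroup X] [NormedSpace ℂ X] [CompleteSpace X]
    (Sg : C0Semigroup X) (domA : Set X) (A : X → X)
    (hgen : IsGeneratorOf Sg domA A) :
    (domA = Set.univ ∧ ∃ C : ℝ, ∀ x : X, ‖A x‖ ≤ C * ‖x‖) ↔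
      (∀ P : X →L[ℂ] X, P.comp P = P →
        ∀ (x : X) (t : ℝ), 0 ≤ t →
          ∃ y : X,
            Tendsto (fun n : ℕ => (((Sg.T (t / n)).comp P) ^ n) x) atTop (𝓝 y)) := by
  constructor
  · rintro ⟨hdom, C, hC⟩ P hP x t ht
    have hA : ∀ x, Tendsto (fun t : ℝ => t⁻¹ • (Sg.T t x - x)) (𝓝[>] 0) (𝓝 (A x)) :=
      fun x => hgen.2 x (hdom ▸ Set.mem_univ x)
    have hadd : ∀ x y, A (x + y) = A x + A y := by
      intro x y
      refine tendsto_nhds_unique (hA (x + y)) (((hA x).add (hA y)).congr fun t => ?_)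
      rw [map_add]; module
    have hsmul : ∀ (c : ℂ) x, A (c • x) = c • A x := by
      intro c x
      refine tendsto_nhds_unique (hA (c • x)) (((hA x).const_smul c).congr fun t => ?_)
      rw [map_smul, smul_comm, smul_sub]
    let A' : X →ₗ[ℂ] X := ⟨⟨A, hadd⟩, hsmul⟩
    exact forward_dir Sg (A'.mkContinuous C hC) hA P hP x t ht
  · intro H
    obtain ⟨C, hC⟩ := Bq_bound Sg H
    obtain ⟨K, hK0, hK⟩ := lip_bound Sg C hC
    have hb := backward_dir Sg K hK0 hK
    have hdom : domA = Set.univ := by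
      refine Set.eq_univ_of_forall fun x => (hgen.1 x).2 ?_
      obtain ⟨y, hy, _⟩ := hb x
      exact ⟨y, hy⟩
    refine ⟨hdom, K, fun x => ?_⟩
    obtain ⟨y, hy, hyK⟩ := hb x
    rwa [tendsto_nhds_unique (hgen.2 x (hdom ▸ Set.mem_univ x)) hy]
end

section
/- Let A be the generator of a C₀-semigroup (e^{tA})_{t≥0} on a complex Banach space X. Then the following are equivalent: (i) A is a bounded operator; (ii) the semigroup e^{tA} is quasi-contractive with respect to every norm on X equivalent to the original norm. -/
open Filter Topology

section helpers

variable {X : Type*} [NormedAddCommGroup X] [NormedSpace ℂ X]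

/-- Orbit differences are `O(t)` on `(0,1]` when the difference quotient converges. -/
lemma orbit_bound (Sg : C0Semigroup X) (x y : X)
    (h : Tendsto (fun t : ℝ => t⁻¹ • (Sg.T t x - x)) (𝓝[>] 0) (𝓝 y)) :
    ∃ C : ℝ, 0 ≤ C ∧ ∀ t ∈ Set.Ioc (0 : ℝ) 1, ‖Sg.T t x - x‖ ≤ C * t := by
  have h1 : ∀ᶠ t in 𝓝[>] (0 : ℝ), ‖t⁻¹ • (Sg.T t x - x)‖ < ‖y‖ + 1 :=
    h.norm.eventually (gt_mem_nhds (by linarith))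
  obtain ⟨δ, hδ, hδ'⟩ := mem_nhdsGT_iff_exists_Ioo_subset.1 h1
  have hδ0 : 0 < δ := hδ
  have hc : ContinuousOn (fun t => Sg.T t x - x) (Set.Icc (0 : ℝ) 1) :=
    ((Sg.T_cont x).mono Set.Icc_subset_Ici_self).sub continuousOn_const
  obtain ⟨B, hB⟩ := isCompact_Icc.exists_bound_of_continuousOn hc
  have hB0 : 0 ≤ B := (norm_nonneg _).trans (hB 0 (by simp))
  refine ⟨(‖y‖ + 1) + B / δ, by positivity, fun t ht => ?_⟩
  have ht0 : 0 < t := ht.1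
  rcases lt_or_ge t δ with hlt | hge
  · have h2 : ‖t⁻¹ • (Sg.T t x - x)‖ < ‖y‖ + 1 := hδ' ⟨ht0, hlt⟩
    rw [norm_smul, norm_inv, Real.norm_of_nonneg ht0.le, inv_mul_lt_iff₀ ht0] at h2
    have : 0 ≤ B / δ * t := by positivity
    linarith
  · have h3 := hB t ⟨ht0.le, ht.2⟩
    have h4 : B ≤ B / δ * t := by
      rw [div_mul_eq_mul_div, le_div_iff₀ hδ0]
      exact mul_le_mul_of_nonneg_left hge hB0
    have : 0 ≤ (‖y‖ + 1) * t := by positivity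
    linarith

lemma exists_dom_approx [CompleteSpace X] (Sg : C0Semigroup X) (x : X) :
    x ∈ closure {z : X | ∃ y : X,
      Tendsto (fun t : ℝ => t⁻¹ • (Sg.T t z - z)) (𝓝[>] 0) (𝓝 y)} := by
  set f : ℝ → X := fun s => Sg.T (max s 0) x with hf
  have hfc : Continuous f := by
    have : ContinuousOn (fun t => Sg.T t x) (Set.Ici 0) := Sg.T_cont x
    exact this.comp_continuous (f := fun s : ℝ => max s 0) (by fun_prop) (fun s => Set.mem_Ici.2 (le_max_right _ _))
  have hf0 : f 0 = x := by simp [hf, Sg.T_zero]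
  set F : ℝ → X := fun u => ∫ s in (0 : ℝ)..u, f s with hF
  have hFd : ∀ u, HasDerivAt F (f u) u := fun u =>
    intervalIntegral.integral_hasDerivAt_right (hfc.intervalIntegrable _ _)
      (hfc.stronglyMeasurableAtFilter _ _) hfc.continuousAt
  have hF0 : F 0 = 0 := by simp [hF]
  have hTF : ∀ h t : ℝ, 0 ≤ h → 0 ≤ t → Sg.T t (F h) = F (h + t) - F t := by
    intro h t hh ht
    have e1 : Sg.T t (F h) = ∫ s in (0 : ℝ)..h, Sg.T t (f s) :=
      ((Sg.T t).intervalIntegral_comp_comm (hfc.intervalIntegrable _ _)).symm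
    have e2 : ∫ s in (0 : ℝ)..h, Sg.T t (f s) = ∫ s in (0 : ℝ)..h, f (s + t) := by
      apply intervalIntegral.integral_congr
      intro s hs
      rw [Set.uIcc_of_le hh] at hs
      have hs0 := hs.1
      simp only [hf]
      rw [max_eq_left hs0, max_eq_left (by linarith), add_comm s t, Sg.T_add t s ht hs0]
      rfl
    rw [e1, e2, intervalIntegral.integral_comp_add_right, zero_add]
    exact (intervalIntegral.integral_interval_sub_left (hfc.intervalIntegrable _ _)
      (hfc.intervalIntegrable _ _)).symm
  have hFdom : ∀ h : ℝ, 0 < h → Tendsto (fun t : ℝ => t⁻¹ • (Sg.T t (F h) - F h)) (𝓝[>] 0)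
      (𝓝 (f h - f 0)) := by
    intro h hh
    have a1 := ((hFd h).tendsto_slope_zero_right)
    have a2 := ((hFd 0).tendsto_slope_zero_right)
    refine (a1.sub a2).congr' ?_
    filter_upwards [self_mem_nhdsWithin] with t ht
    have ht' : 0 < t := ht
    rw [hTF h t hh.le ht'.le, ← smul_sub, zero_add, hF0]
    congr 1
    abel
  have hlim : Tendsto (fun h : ℝ => h⁻¹ • F h) (𝓝[>] 0) (𝓝 x) := by
    have a2 := ((hFd 0).tendsto_slope_zero_right)
    simpa [hF0, hf0] using a2
  refine mem_closure_of_tendsto hlim ?_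
  filter_upwards [self_mem_nhdsWithin] with h hh
  refine ⟨h⁻¹ • (f h - f 0), ?_⟩
  refine ((hFdom h hh).const_smul h⁻¹).congr fun t => ?_
  have : Sg.T t (h⁻¹ • F h) = h⁻¹ • Sg.T t (F h) := (Sg.T t).map_smul_of_tower _ _
  rw [this, ← smul_sub, smul_comm]

/-- everything from the linear estimate at the origin -/
lemma quasi_of_bound (Sg : C0Semigroup X) (K : ℝ) (hK0 : 0 ≤ K)
    (hK : ∀ t ∈ Set.Ioc (0 : ℝ) 1, ∀ x, ‖Sg.T t x - x‖ ≤ K * t * ‖x‖)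
    (N : X → ℝ) (hadd : ∀ z w : X, N (z + w) ≤ N z + N w)
    (c C : ℝ) (hc : 0 < c) (hC : 0 < C) (hN : ∀ z : X, c * ‖z‖ ≤ N z ∧ N z ≤ C * ‖z‖) :
    ∃ lam : ℝ, ∀ t : ℝ, 0 ≤ t → ∀ x : X, N (Sg.T t x) ≤ Real.exp (lam * t) * N x := by
  set L := C * K / c with hL
  have hsmall : ∀ t ∈ Set.Ioc (0 : ℝ) 1, ∀ x, N (Sg.T t x) ≤ Real.exp (L * t) * N x := by
    intro t ht x
    have h1 : N (Sg.T t x) ≤ N x + N (Sg.T t x - x) := by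
      have := hadd x (Sg.T t x - x)
      rwa [add_sub_cancel] at this
    have h2 : N (Sg.T t x - x) ≤ C * (K * t * ‖x‖) :=
      (hN _).2.trans (mul_le_mul_of_nonneg_left (hK t ht x) hC.le)
    have h3 : ‖x‖ ≤ N x / c := by
      rw [le_div_iff₀ hc]; linarith [(hN x).1]
    have hNx : 0 ≤ N x := le_trans (by positivity) (hN x).1
    have ht0 : 0 ≤ t := ht.1.le
    have h4 : C * (K * t * ‖x‖) ≤ C * (K * t * (N x / c)) := by gcongr
    have h5 : C * (K * t * (N x / c)) = L * t * N x := by rw [hL]; ring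
    have h6 : (L * t + 1) * N x ≤ Real.exp (L * t) * N x :=
      mul_le_mul_of_nonneg_right (Real.add_one_le_exp _) hNx
    linarith
  have hind : ∀ n : ℕ, ∀ t ∈ Set.Ioc (0 : ℝ) 1, ∀ x,
      N (Sg.T (n * t) x) ≤ Real.exp (L * (n * t)) * N x := by
    intro n t ht x
    induction n with
    | zero => simp [Sg.T_zero]
    | succ n ih =>
      have e : ((n + 1 : ℕ) : ℝ) * t = t + n * t := by push_cast; ring
      rw [e, Sg.T_add t (n * t) ht.1.le (mul_nonneg n.cast_nonneg ht.1.le), mul_add, Real.exp_add,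
        mul_assoc]
      exact (hsmall t ht _).trans (mul_le_mul_of_nonneg_left ih (Real.exp_pos _).le)
  refine ⟨L, fun t ht x => ?_⟩
  rcases ht.eq_or_lt with rfl | ht
  · simp [Sg.T_zero]
  obtain ⟨n, hn⟩ := exists_nat_gt t
  have hn0 : (0 : ℝ) < n := ht.trans hn
  have := hind n (t / n) ⟨by positivity, by rw [div_le_one hn0]; exact hn.le⟩ x
  rwa [mul_div_cancel₀ _ hn0.ne'] at this

/-- functional estimate -/
lemma functional_bound [CompleteSpace X] (Sg : C0Semigroup X)
    (H : ∀ N : X → ℝ,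
        (∀ z w : X, N (z + w) ≤ N z + N w) →
        (∀ (c : ℂ) (z : X), N (c • z) = ‖c‖ * N z) →
        (∃ c C : ℝ, 0 < c ∧ 0 < C ∧ ∀ z : X, c * ‖z‖ ≤ N z ∧ N z ≤ C * ‖z‖) →
        ∃ lam : ℝ, ∀ t : ℝ, 0 ≤ t → ∀ x : X,
          N (Sg.T t x) ≤ Real.exp (lam * t) * N x)
    (φ : X →L[ℂ] ℂ) :
    ∃ D : ℝ, ∀ t ∈ Set.Ioc (0 : ℝ) 1, ∀ x, ‖x‖ ≤ 1 → ‖φ (Sg.T t x - x)‖ ≤ D * t := by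
  by_cases hφ : φ = 0
  · exact ⟨0, by simp [hφ]⟩
  -- a vector of the domain with `φ e = 1`
  obtain ⟨e, y, he1, hey⟩ : ∃ e y : X, φ e = 1 ∧
      Tendsto (fun t : ℝ => t⁻¹ • (Sg.T t e - e)) (𝓝[>] 0) (𝓝 y) := by
    obtain ⟨x, hx⟩ : ∃ x, φ x ≠ 0 := by
      by_contra! h
      exact hφ (ContinuousLinearMap.ext h)
    have ho : IsOpen {z | φ z ≠ 0} := isOpen_ne_fun φ.continuous continuous_const
    obtain ⟨z, hz, y, hzy⟩ := mem_closure_iff.1 (exists_dom_approx Sg x) _ ho hx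
    have hz' : φ z ≠ 0 := hz
    refine ⟨(φ z)⁻¹ • z, (φ z)⁻¹ • y, by simp [hz'], ?_⟩
    refine (hzy.const_smul (φ z)⁻¹).congr fun t => ?_
    rw [map_smul, ← smul_sub, smul_comm]
  obtain ⟨C, hC0, hC⟩ := orbit_bound Sg e y hey
  set R := 1 + ‖φ‖ * ‖e‖ with hR
  have hR0 : 0 < R := by positivity
  set M := ‖e‖ + R with hM
  have hM0 : 0 < M := by positivity
  obtain ⟨lam, hlam⟩ := H (fun x => max ‖x‖ (M * ‖φ x‖))
    (by
      intro z w
      apply max_le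
      · exact (norm_add_le _ _).trans (add_le_add (le_max_left _ _) (le_max_left _ _))
      · rw [map_add]
        calc M * ‖φ z + φ w‖ ≤ M * (‖φ z‖ + ‖φ w‖) := by gcongr; exact norm_add_le _ _
          _ = M * ‖φ z‖ + M * ‖φ w‖ := by ring
          _ ≤ _ := add_le_add (le_max_right _ _) (le_max_right _ _))
    (by
      intro c z
      simp only [map_smul, norm_smul]
      rw [mul_max_of_nonneg _ _ (norm_nonneg c)]
      congr 1
      ring)
    ⟨1, 1 + M * ‖φ‖, one_pos, by positivity, by
      intro z
      refine ⟨by simp, max_le ?_ ?_⟩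
      · have : 0 ≤ M * ‖φ‖ * ‖z‖ := by positivity
        linarith
      · have : M * ‖φ z‖ ≤ M * (‖φ‖ * ‖z‖) := by gcongr; exact φ.le_opNorm z
        nlinarith [norm_nonneg z]⟩
  have hexp : ∀ t ∈ Set.Ioc (0 : ℝ) 1, Real.exp (lam * t) ≤ 1 + (Real.exp lam - 1) * t := by
    intro t ht
    have := convexOn_exp.2 (Set.mem_univ 0) (Set.mem_univ lam)
      (sub_nonneg.2 ht.2) ht.1.le (by ring)
    simp only [smul_eq_mul, mul_zero, zero_add, Real.exp_zero, mul_one] at this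
    rw [mul_comm lam t]
    linarith
  have hTe : ∀ t ∈ Set.Ioc (0 : ℝ) 1, ‖φ (Sg.T t e) - 1‖ ≤ ‖φ‖ * C * t := by
    intro t ht
    rw [← he1, ← map_sub, mul_assoc]
    exact (φ.le_opNorm _).trans (mul_le_mul_of_nonneg_left (hC t ht) (norm_nonneg _))
  have hker : ∀ t ∈ Set.Ioc (0 : ℝ) 1, ∀ z, φ z = 0 → ‖z‖ ≤ R →
      ‖φ (Sg.T t z)‖ ≤ (Real.exp lam - 1 + ‖φ‖ * C) * t := by
    intro t ht z hz hzR
    obtain ⟨c, hc, hcz⟩ := RCLike.exists_norm_eq_mul_self (φ (Sg.T t z))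
    have h1 := hlam t ht.1.le (e + c • z)
    have h2 : max ‖e + c • z‖ (M * ‖φ (e + c • z)‖) ≤ M := by
      apply max_le
      · refine (norm_add_le _ _).trans ?_
        rw [norm_smul, hc, one_mul]
        linarith
      · simp [he1, hz]
    have h3 : M * ‖φ (Sg.T t (e + c • z))‖ ≤ M * Real.exp (lam * t) := by
      calc _ ≤ _ := le_max_right _ _
        _ ≤ _ := h1
        _ ≤ Real.exp (lam * t) * M := mul_le_mul_of_nonneg_left h2 (Real.exp_pos _).le
        _ = _ := mul_comm _ _
    have h4 := le_of_mul_le_mul_left h3 hM0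
    rw [map_add, map_add, map_smul, map_smul, smul_eq_mul, ← hcz] at h4
    have h5 : 1 + ‖φ (Sg.T t z)‖ ≤
        ‖φ (Sg.T t e) + (‖φ (Sg.T t z)‖ : ℂ)‖ + ‖φ (Sg.T t e) - 1‖ := by
      have a : ‖(1 : ℂ) + (‖φ (Sg.T t z)‖ : ℂ)‖ = 1 + ‖φ (Sg.T t z)‖ := by
        rw [← Complex.ofReal_one, ← Complex.ofReal_add, Complex.norm_real,
          Real.norm_of_nonneg (by positivity)]
      rw [← a]
      refine le_trans (le_of_eq ?_) (norm_sub_le _ _)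
      congr 1
      ring
    have h6 := hTe t ht
    have h7 := hexp t ht
    have h4' : ‖φ (Sg.T t e) + (‖φ (Sg.T t z)‖ : ℂ)‖ ≤ Real.exp (lam * t) := h4
    linarith
  refine ⟨(Real.exp lam - 1 + ‖φ‖ * C) + ‖φ‖ * (‖φ‖ * C), fun t ht x hx => ?_⟩
  have hφx : ‖φ x‖ ≤ ‖φ‖ :=
    (φ.le_opNorm x).trans (mul_le_of_le_one_right (norm_nonneg _) hx)
  have hz := hker t ht (x - φ x • e) (by simp [he1]) (by
    refine (norm_sub_le _ _).trans ?_
    rw [norm_smul, hR]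
    gcongr)
  have hdec : φ (Sg.T t x - x) = φ (Sg.T t (x - φ x • e)) + φ x * (φ (Sg.T t e) - 1) := by
    simp only [map_sub, map_smul, smul_eq_mul]
    ring
  rw [hdec]
  refine (norm_add_le _ _).trans ?_
  rw [norm_mul, add_mul]
  refine add_le_add hz ?_
  rw [mul_assoc]
  exact mul_le_mul hφx (hTe t ht) (norm_nonneg _) (norm_nonneg _)

/-- uniform boundedness in the dual -/
lemma bound_of_functional (Sg : C0Semigroup X)
    (H : ∀ φ : X →L[ℂ] ℂ, ∃ D : ℝ, ∀ t ∈ Set.Ioc (0 : ℝ) 1, ∀ x, ‖x‖ ≤ 1 →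
      ‖φ (Sg.T t x - x)‖ ≤ D * t) :
    ∃ K : ℝ, 0 ≤ K ∧ ∀ t ∈ Set.Ioc (0 : ℝ) 1, ∀ x, ‖Sg.T t x - x‖ ≤ K * t * ‖x‖ := by
  let g : {p : ℝ × X // p.1 ∈ Set.Ioc (0 : ℝ) 1 ∧ ‖p.2‖ ≤ 1} → ((X →L[ℂ] ℂ) →L[ℂ] ℂ) :=
    fun p => NormedSpace.inclusionInDoubleDual ℂ X
      (((p.1.1 : ℝ) : ℂ)⁻¹ • (Sg.T p.1.1 p.1.2 - p.1.2))
  have hg : ∀ φ : X →L[ℂ] ℂ, ∃ D, ∀ p, ‖g p φ‖ ≤ D := by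
    intro φ
    obtain ⟨D, hD⟩ := H φ
    refine ⟨D, fun p => ?_⟩
    have h1 := hD p.1.1 p.2.1 p.1.2 p.2.2
    have hp : 0 < p.1.1 := p.2.1.1
    change ‖φ (((p.1.1 : ℝ) : ℂ)⁻¹ • (Sg.T p.1.1 p.1.2 - p.1.2))‖ ≤ D
    rw [map_smul, norm_smul, norm_inv, Complex.norm_real, Real.norm_of_nonneg hp.le, inv_mul_le_iff₀ hp]
    linarith
  obtain ⟨K, hK⟩ := banach_steinhaus hg
  refine ⟨max K 0, le_max_right _ _, fun t ht x => ?_⟩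
  have hunit : ∀ x : X, ‖x‖ ≤ 1 → ‖Sg.T t x - x‖ ≤ max K 0 * t := by
    intro x hx
    have h1 := hK ⟨(t, x), ht, hx⟩
    have h2 : ‖((t : ℝ) : ℂ)⁻¹ • (Sg.T t x - x)‖ ≤ K := by
      rw [← (NormedSpace.inclusionInDoubleDualLi ℂ (E := X)).norm_map]
      exact h1
    rw [norm_smul, norm_inv, Complex.norm_real, Real.norm_of_nonneg ht.1.le,
      inv_mul_le_iff₀ ht.1] at h2
    have := mul_le_mul_of_nonneg_right (le_max_left K 0) ht.1.le
    linarith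
  by_cases hx : x = 0
  · simp [hx]
  have hx0 : 0 < ‖x‖ := norm_pos_iff.2 hx
  have h3 := hunit (((‖x‖ : ℝ) : ℂ)⁻¹ • x) (by
    rw [norm_smul, norm_inv, Complex.norm_real, norm_norm, inv_mul_cancel₀ hx0.ne'])
  rw [map_smul, ← smul_sub, norm_smul, norm_inv, Complex.norm_real, norm_norm,
    inv_mul_le_iff₀ hx0] at h3
  linarith

lemma dom_univ_of_bound [CompleteSpace X] (Sg : C0Semigroup X) (K : ℝ) (hK0 : 0 ≤ K)
    (hK : ∀ t ∈ Set.Ioc (0 : ℝ) 1, ∀ x, ‖Sg.T t x - x‖ ≤ K * t * ‖x‖) (x : X) :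
    ∃ y : X, Tendsto (fun t : ℝ => t⁻¹ • (Sg.T t x - x)) (𝓝[>] 0) (𝓝 y) := by
  have hev : ∀ᶠ t in 𝓝[>] (0 : ℝ), t ∈ Set.Ioc (0 : ℝ) 1 := Ioc_mem_nhdsGT one_pos
  apply cauchy_map_iff_exists_tendsto.1
  rw [Metric.cauchy_iff]
  refine ⟨inferInstance, fun ε hε => ?_⟩
  obtain ⟨z, ⟨y, hy⟩, hz⟩ := Metric.mem_closure_iff.1 (exists_dom_approx Sg x)
    (ε / (4 * (K + 1))) (by positivity)
  have h1 : ∀ᶠ t in 𝓝[>] (0 : ℝ), dist (t⁻¹ • (Sg.T t z - z)) y < ε / 4 :=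
    Metric.tendsto_nhds.1 hy _ (by positivity)
  have h2 : ∀ᶠ t in 𝓝[>] (0 : ℝ), dist (t⁻¹ • (Sg.T t x - x)) y < ε / 2 := by
    filter_upwards [h1, hev] with t ht1 ht
    have ht0 : 0 < t := ht.1
    have h3 : dist (t⁻¹ • (Sg.T t x - x)) (t⁻¹ • (Sg.T t z - z)) ≤ K * dist x z := by
      rw [dist_eq_norm, dist_eq_norm, ← smul_sub, norm_smul, norm_inv,
        Real.norm_of_nonneg ht0.le, inv_mul_le_iff₀ ht0]
      have := hK t ht (x - z)
      rw [map_sub] at this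
      calc _ = ‖Sg.T t x - Sg.T t z - (x - z)‖ := by congr 1; abel
        _ ≤ _ := this
        _ = _ := by ring
    have h4 : K * dist x z ≤ ε / 4 := by
      have : (K + 1) * dist x z ≤ (K + 1) * (ε / (4 * (K + 1))) := by gcongr
      have e : (K + 1) * (ε / (4 * (K + 1))) = ε / 4 := by field_simp
      nlinarith [dist_nonneg (x := x) (y := z)]
    have := dist_triangle (t⁻¹ • (Sg.T t x - x)) (t⁻¹ • (Sg.T t z - z)) y
    linarith
  refine ⟨Metric.ball y (ε / 2), h2, fun a ha b hb => ?_⟩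
  have := dist_triangle_right a b y
  rw [Metric.mem_ball] at ha hb
  linarith

end helpers

/-- the generator `A` is bounded iff the semigroup is quasi-contractive
with respect to every norm on `X` equivalent to the original norm. -/
theorem stmt_3 {X : Type*} [NormedAddCommGroup X] [NormedSpace ℂ X] [CompleteSpace X]
    (Sg : C0Semigroup X) (domA : Set X) (A : X → X)
    (hgen : IsGeneratorOf Sg domA A) :
    (domA = Set.univ ∧ ∃ C : ℝ, ∀ x : X, ‖A x‖ ≤ C * ‖x‖) ↔
      (∀ N : X → ℝ,
        (∀ z w : X, N (z + w) ≤ N z + N w) →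
        (∀ (c : ℂ) (z : X), N (c • z) = ‖c‖ * N z) →
        (∃ c C : ℝ, 0 < c ∧ 0 < C ∧ ∀ z : X, c * ‖z‖ ≤ N z ∧ N z ≤ C * ‖z‖) →
        ∃ lam : ℝ, ∀ t : ℝ, 0 ≤ t → ∀ x : X,
          N (Sg.T t x) ≤ Real.exp (lam * t) * N x) := by
  constructor
  · rintro ⟨hdom, -⟩ N hadd - ⟨c, C, hc, hC, hN⟩
    have hpt : ∀ x : X, ∃ C : ℝ, 0 ≤ C ∧ ∀ t ∈ Set.Ioc (0 : ℝ) 1, ‖Sg.T t x - x‖ ≤ C * t :=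
      fun x => orbit_bound Sg x (A x) (hgen.2 x (by rw [hdom]; trivial))
    have hg : ∀ x : X, ∃ D, ∀ p : Set.Ioc (0 : ℝ) 1,
        ‖(((p : ℝ) : ℂ)⁻¹ • (Sg.T p - 1)) x‖ ≤ D := by
      intro x
      obtain ⟨D, -, hD⟩ := hpt x
      refine ⟨D, fun p => ?_⟩
      have hp : 0 < (p : ℝ) := p.2.1
      have h1 : ‖Sg.T p x - x‖ ≤ D * p := hD p p.2
      change ‖((p : ℝ) : ℂ)⁻¹ • (Sg.T p x - x)‖ ≤ D
      rw [norm_smul, norm_inv, Complex.norm_real, Real.norm_of_nonneg hp.le, inv_mul_le_iff₀ hp]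
      linarith
    obtain ⟨K, hK⟩ := banach_steinhaus hg
    refine quasi_of_bound Sg (max K 0) (le_max_right _ _) (fun t ht x => ?_) N hadd c C hc hC hN
    have ht0 : 0 < t := ht.1
    have h1 : ‖((t : ℝ) : ℂ)⁻¹ • (Sg.T t x - x)‖ ≤ max K 0 * ‖x‖ :=
      (((t : ℂ)⁻¹ • (Sg.T t - 1)).le_opNorm x).trans
        (mul_le_mul_of_nonneg_right ((hK ⟨t, ht⟩).trans (le_max_left _ _)) (norm_nonneg _))
    rw [norm_smul, norm_inv, Complex.norm_real, Real.norm_of_nonneg ht0.le,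
      inv_mul_le_iff₀ ht0] at h1
    linarith
  · intro H
    obtain ⟨K, hK0, hK⟩ := bound_of_functional Sg (functional_bound Sg H)
    have hdom : domA = Set.univ :=
      Set.eq_univ_of_forall fun x => (hgen.1 x).2 (dom_univ_of_bound Sg K hK0 hK x)
    refine ⟨hdom, K, fun x => ?_⟩
    refine le_of_tendsto (hgen.2 x (by rw [hdom]; trivial)).norm ?_
    filter_upwards [Ioc_mem_nhdsGT (one_pos : (0 : ℝ) < 1)] with t ht
    have ht0 : 0 < t := ht.1
    rw [norm_smul, norm_inv, Real.norm_of_nonneg ht0.le, inv_mul_le_iff₀ ht0]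
    linarith [hK t ht x]
end

section
/- Let A be the generator of a C₀-semigroup (e^{tA})_{t≥0} on a complex Banach space X, and assume A is unbounded. Then there exists a norm ‖·‖₀ on X, equivalent to the original norm, with respect to which the semigroup is not quasi-contractive: for every λ ∈ ℝ there exist t ≥ 0 and x ∈ X with ‖e^{tA}x‖₀ > e^{λt}‖x‖₀. -/
open Filter Topology

lemma c0_bound_dom {X : Type*} [NormedAddCommGroup X] [NormedSpace ℂ X]
    (Sg : C0Semigroup X) (x y : X)
    (h : Tendsto (fun t : ℝ => t⁻¹ • (Sg.T t x - x)) (𝓝[>] 0) (𝓝 y)) :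
    ∃ C : ℝ, 0 ≤ C ∧ ∀ t : ℝ, 0 < t → t ≤ 1 → ‖Sg.T t x - x‖ ≤ C * t := by
  have h1 : ∀ᶠ t in 𝓝[>] (0:ℝ), ‖t⁻¹ • (Sg.T t x - x)‖ < ‖y‖ + 1 :=
    h.norm.eventually_lt_const (by linarith)
  obtain ⟨d, hd, hd'⟩ := mem_nhdsGT_iff_exists_Ioo_subset.1 h1
  have hd0 : (0:ℝ) < d := hd
  have hc : ContinuousOn (fun t => ‖Sg.T t x - x‖) (Set.Icc (0:ℝ) 1) :=
    (((Sg.T_cont x).mono (fun t ht => ht.1)).sub continuousOn_const).norm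
  obtain ⟨M, hM⟩ := isCompact_Icc.bddAbove_image hc
  have hM' : ∀ t : ℝ, 0 ≤ t → t ≤ 1 → ‖Sg.T t x - x‖ ≤ M := fun t h0 h1 =>
    hM ⟨t, ⟨h0, h1⟩, rfl⟩
  have hM0 : 0 ≤ M := (norm_nonneg _).trans (hM' 0 le_rfl zero_le_one)
  refine ⟨‖y‖ + 1 + M / d, by positivity, fun t h0 h1 => ?_⟩
  rcases lt_or_ge t d with htd | htd
  · have h2 : ‖t⁻¹ • (Sg.T t x - x)‖ < ‖y‖ + 1 := hd' ⟨h0, htd⟩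
    rw [norm_smul, norm_inv, Real.norm_of_nonneg h0.le, inv_mul_lt_iff₀ h0] at h2
    have : 0 ≤ M / d * t := by positivity
    nlinarith
  · have h3 : M ≤ M / d * t := by
      rw [div_mul_eq_mul_div, le_div_iff₀ hd0]; gcongr
    have : 0 ≤ (‖y‖ + 1) * t := by positivity
    have := hM' t h0.le h1
    nlinarith

lemma c0_avg_tendsto {X : Type*} [NormedAddCommGroup X] [NormedSpace ℂ X] [CompleteSpace X]
    (g : ℝ → X) (hg : Continuous g) (a : ℝ) :
    Tendsto (fun t : ℝ => t⁻¹ • ∫ s in a..(a + t), g s) (𝓝[>] 0) (𝓝 (g a)) := by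
  have h : HasDerivAt (fun u => ∫ s in a..u, g s) (g a) a :=
    intervalIntegral.integral_hasDerivAt_right (hg.intervalIntegrable _ _)
      hg.stronglyMeasurable.stronglyMeasurableAtFilter hg.continuousAt
  have := h.tendsto_slope_zero_right
  simpa using this

lemma c0_dense {X : Type*} [NormedAddCommGroup X] [NormedSpace ℂ X] [CompleteSpace X]
    (Sg : C0Semigroup X) :
    Dense {x : X | ∃ y : X, Tendsto (fun t : ℝ => t⁻¹ • (Sg.T t x - x)) (𝓝[>] 0) (𝓝 y)} := by
  intro x
  set g : ℝ → X := fun s => Sg.T (max s 0) x with hgdef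
  have hg : Continuous g :=
    (Sg.T_cont x).comp_continuous (continuous_id.max continuous_const) (fun s => Set.mem_Ici.2 (le_max_right _ _))
  have hg0 : g 0 = x := by simp [hgdef, Sg.T_zero]
  have hlim := c0_avg_tendsto g hg 0
  rw [hg0] at hlim
  refine mem_closure_of_tendsto hlim ?_
  filter_upwards [self_mem_nhdsWithin] with h hh
  have hh0 : (0:ℝ) < h := hh
  refine ⟨h⁻¹ • (g h - g 0), ?_⟩
  have hl2 := ((c0_avg_tendsto g hg h).sub (c0_avg_tendsto g hg 0)).const_smul h⁻¹
  refine hl2.congr' ?_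
  filter_upwards [self_mem_nhdsWithin] with t ht
  have ht0 : (0:ℝ) < t := ht
  have key : Sg.T t (∫ s in (0:ℝ)..h, g s) = ∫ s in t..(h + t), g s := by
    rw [← ContinuousLinearMap.intervalIntegral_comp_comm _ (hg.intervalIntegrable _ _)]
    have : ∫ s in (0:ℝ)..h, Sg.T t (g s) = ∫ s in (0:ℝ)..h, g (s + t) := by
      apply intervalIntegral.integral_congr
      intro s hs
      rw [Set.uIcc_of_le hh0.le] at hs
      simp only [hgdef]
      rw [max_eq_left hs.1, max_eq_left (by linarith [hs.1]), add_comm s t,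
        Sg.T_add t s ht0.le hs.1]
      rfl
    rw [this, intervalIntegral.integral_comp_add_right]
    simp
  have e1 := intervalIntegral.integral_add_adjacent_intervals
    (hg.intervalIntegrable (μ := MeasureTheory.volume) 0 t) (hg.intervalIntegrable t (h + t))
  have e2 := intervalIntegral.integral_add_adjacent_intervals
    (hg.intervalIntegrable (μ := MeasureTheory.volume) 0 h) (hg.intervalIntegrable h (h + t))
  have e3 : (∫ s in t..(h + t), g s) - (∫ s in (0:ℝ)..h, g s)
      = (∫ s in h..(h + t), g s) - ∫ s in (0:ℝ)..t, g s := by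
    rw [sub_eq_sub_iff_add_eq_add]
    have e5 := e1.trans e2.symm
    rw [add_comm, e5, add_comm (∫ s in (0:ℝ)..h, g s)]
  have e4 : Sg.T t (h⁻¹ • ∫ s in (0:ℝ)..h, g s) = h⁻¹ • Sg.T t (∫ s in (0:ℝ)..h, g s) :=
    (Sg.T t).map_smul_of_tower _ _
  simp only [zero_add]
  rw [e4, key, ← smul_sub, ← smul_sub, e3, smul_comm]

lemma c0_phase (a b : ℂ) : ∃ c : ℂ, ‖c‖ = 1 ∧ ‖a + c * b‖ = ‖a‖ + ‖b‖ := by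
  refine ⟨Complex.exp (((a.arg - b.arg : ℝ) : ℂ) * Complex.I),
    Complex.norm_exp_ofReal_mul_I _, ?_⟩
  have h : a + Complex.exp (((a.arg - b.arg : ℝ) : ℂ) * Complex.I) * b
      = ((‖a‖ + ‖b‖ : ℝ) : ℂ) * Complex.exp ((a.arg : ℂ) * Complex.I) := by
    have e : Complex.exp ((a.arg : ℂ) * Complex.I)
        = Complex.exp (((a.arg - b.arg : ℝ) : ℂ) * Complex.I)
          * Complex.exp ((b.arg : ℂ) * Complex.I) := by
      rw [← Complex.exp_add]; push_cast; ring_nf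
    have ha := Complex.norm_mul_exp_arg_mul_I a
    have hb := Complex.norm_mul_exp_arg_mul_I b
    rw [Complex.ofReal_add, add_mul, ha]
    rw [e]
    linear_combination (-Complex.exp (((a.arg - b.arg : ℝ) : ℂ) * Complex.I)) * hb
  rw [h, norm_mul, Complex.norm_exp_ofReal_mul_I, Complex.norm_real,
    Real.norm_of_nonneg (by positivity), mul_one]

/-- Pointwise bound for a functional, assuming quasi-contractivity for all equivalent norms. -/
lemma c0_functional {X : Type*} [NormedAddCommGroup X] [NormedSpace ℂ X] [CompleteSpace X]
    (Sg : C0Semigroup X)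
    (H : ∀ N : X → ℝ, (∀ z w : X, N (z + w) ≤ N z + N w) →
      (∀ (c : ℂ) (z : X), N (c • z) = ‖c‖ * N z) →
      (∃ c C : ℝ, 0 < c ∧ 0 < C ∧ ∀ z : X, c * ‖z‖ ≤ N z ∧ N z ≤ C * ‖z‖) →
      ∃ lam : ℝ, ∀ t : ℝ, 0 ≤ t → ∀ x : X, N (Sg.T t x) ≤ Real.exp (lam * t) * N x)
    (φ : X →L[ℂ] ℂ) :
    ∃ C : ℝ, ∀ t : ℝ, 0 < t → t ≤ 1 → ∀ x : X, ‖φ (Sg.T t x - x)‖ ≤ C * t * ‖x‖ := by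
  by_cases hφ : ∀ x ∈ {x : X | ∃ y : X,
      Tendsto (fun t : ℝ => t⁻¹ • (Sg.T t x - x)) (𝓝[>] 0) (𝓝 y)}, φ x = 0
  · have : (φ : X → ℂ) = fun _ => 0 :=
      Continuous.ext_on (c0_dense Sg) φ.continuous continuous_const hφ
    refine ⟨0, fun t _ _ x => ?_⟩
    rw [congrFun this]; simp
  push Not at hφ
  obtain ⟨x0, ⟨y0, hy0⟩, hx0⟩ := hφ
  obtain ⟨C0, hC0, hb⟩ := c0_bound_dom Sg x0 y0 hy0
  have hp : 0 < ‖φ x0‖ := norm_pos_iff.2 hx0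
  set K : ℝ := (‖x0‖ + 1) / ‖φ x0‖ with hK
  have hK0 : 0 < K := by positivity
  have hKφ : K * ‖φ x0‖ = ‖x0‖ + 1 := by rw [hK]; field_simp
  obtain ⟨lam, hlam⟩ := H (fun z => max ‖z‖ (K * ‖φ z‖))
    (by
      intro z w
      apply max_le
      · exact (norm_add_le z w).trans (add_le_add (le_max_left _ _) (le_max_left _ _))
      · rw [map_add]
        calc K * ‖φ z + φ w‖ ≤ K * (‖φ z‖ + ‖φ w‖) := by gcongr; exact norm_add_le _ _
          _ = K * ‖φ z‖ + K * ‖φ w‖ := by ring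
          _ ≤ _ := add_le_add (le_max_right _ _) (le_max_right _ _))
    (by
      intro c z
      rw [map_smul, norm_smul, norm_smul, mul_max_of_nonneg _ _ (norm_nonneg _)]
      congr 1; ring)
    ⟨1, 1 + K * ‖φ‖, one_pos, by positivity, fun z => ⟨by rw [one_mul]; exact le_max_left _ _, by
      have h1 := φ.le_opNorm z
      have h2 : K * ‖φ z‖ ≤ K * (‖φ‖ * ‖z‖) := by gcongr
      have h3 : 0 ≤ K * (‖φ‖ * ‖z‖) := by positivity
      apply max_le
      · nlinarith [norm_nonneg z]
      · nlinarith [norm_nonneg z]⟩⟩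
  -- exponential bound
  obtain ⟨E, hE0, hE⟩ : ∃ E : ℝ, 0 ≤ E ∧ ∀ t : ℝ, 0 < t → t ≤ 1 →
      Real.exp (lam * t) ≤ 1 + E * t := by
    refine ⟨Real.exp |lam| - 1, by linarith [Real.add_one_le_exp |lam|, abs_nonneg lam],
      fun t h0 h1 => ?_⟩
    have hc := convexOn_exp.2 (Set.mem_univ (0:ℝ)) (Set.mem_univ |lam|)
      (by linarith : (0:ℝ) ≤ 1 - t) h0.le (by ring)
    simp only [smul_eq_mul, mul_zero, zero_add, Real.exp_zero, mul_one] at hc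
    have : Real.exp (lam * t) ≤ Real.exp (t * |lam|) := by
      apply Real.exp_le_exp.2; nlinarith [le_abs_self lam]
    nlinarith
  -- kernel bound
  have hker1 : ∀ t : ℝ, 0 < t → t ≤ 1 → ∀ y : X, φ y = 0 → ‖y‖ ≤ 1 →
      ‖φ (Sg.T t y)‖ ≤ (E * ‖φ x0‖ + ‖φ‖ * C0) * t := by
    intro t h0 h1 y hy hy1
    obtain ⟨c, hc, hcab⟩ := c0_phase (φ (Sg.T t x0)) (φ (Sg.T t y))
    have h2 := hlam t h0.le (x0 + c • y)
    have h3 : max ‖x0 + c • y‖ (K * ‖φ (x0 + c • y)‖) = K * ‖φ x0‖ := by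
      rw [map_add, map_smul, hy, smul_zero, add_zero]
      apply max_eq_right
      rw [hKφ]
      refine (norm_add_le _ _).trans ?_
      rw [norm_smul, hc]; linarith
    simp only [h3] at h2
    have h4 := (le_max_right _ _).trans h2
    rw [map_add, map_add, map_smul, map_smul, smul_eq_mul, hcab] at h4
    have h5 : ‖φ (Sg.T t x0)‖ + ‖φ (Sg.T t y)‖ ≤ Real.exp (lam * t) * ‖φ x0‖ := by
      have : K * (‖φ (Sg.T t x0)‖ + ‖φ (Sg.T t y)‖) ≤ K * (Real.exp (lam * t) * ‖φ x0‖) := by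
        linarith
      exact le_of_mul_le_mul_left this hK0
    have h6 : ‖φ x0‖ - ‖φ (Sg.T t x0)‖ ≤ ‖φ‖ * (C0 * t) := by
      calc ‖φ x0‖ - ‖φ (Sg.T t x0)‖ ≤ ‖φ x0 - φ (Sg.T t x0)‖ := norm_sub_norm_le _ _
        _ = ‖φ (Sg.T t x0 - x0)‖ := by rw [map_sub, norm_sub_rev]
        _ ≤ ‖φ‖ * ‖Sg.T t x0 - x0‖ := φ.le_opNorm _
        _ ≤ _ := by gcongr; exact hb t h0 h1
    have h7 := mul_le_mul_of_nonneg_right (hE t h0 h1) hp.le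
    linarith
  set D := E * ‖φ x0‖ + ‖φ‖ * C0 with hD
  have hD0 : 0 ≤ D := by positivity
  have hker : ∀ t : ℝ, 0 < t → t ≤ 1 → ∀ y : X, φ y = 0 →
      ‖φ (Sg.T t y)‖ ≤ D * t * ‖y‖ := by
    intro t h0 h1 y hy
    by_cases hy0 : y = 0
    · simp [hy0]
    have hyp : 0 < ‖y‖ := norm_pos_iff.2 hy0
    have h2 := hker1 t h0 h1 (((‖y‖⁻¹ : ℝ) : ℂ) • y) (by rw [map_smul, hy, smul_zero])
      (by rw [norm_smul, Complex.norm_real, norm_inv, norm_norm, inv_mul_cancel₀ hyp.ne'])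
    rw [map_smul, map_smul, norm_smul, Complex.norm_real, norm_inv, norm_norm,
      inv_mul_le_iff₀ hyp] at h2
    linarith
  refine ⟨‖φ‖ / ‖φ x0‖ * (‖φ‖ * C0) + D * (1 + ‖φ‖ / ‖φ x0‖ * ‖x0‖), fun t h0 h1 x => ?_⟩
  set q : ℂ := φ x / φ x0 with hq
  have hqn : ‖q‖ ≤ ‖φ‖ / ‖φ x0‖ * ‖x‖ := by
    rw [hq, norm_div, div_mul_eq_mul_div]; gcongr; exact φ.le_opNorm x
  have hy : φ (x - q • x0) = 0 := by
    rw [map_sub, map_smul, smul_eq_mul, hq]; field_simp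
    try ring
  have hyn : ‖x - q • x0‖ ≤ (1 + ‖φ‖ / ‖φ x0‖ * ‖x0‖) * ‖x‖ := by
    calc ‖x - q • x0‖ ≤ ‖x‖ + ‖q‖ * ‖x0‖ := by
          rw [← norm_smul]; exact norm_sub_le _ _
      _ ≤ ‖x‖ + ‖φ‖ / ‖φ x0‖ * ‖x‖ * ‖x0‖ := by gcongr
      _ = _ := by ring
  have hdec : φ (Sg.T t x - x) = q * φ (Sg.T t x0 - x0) + φ (Sg.T t (x - q • x0)) := by
    have : φ x = q * φ x0 := by rw [hq]; field_simp
    simp only [map_sub, map_smul, smul_eq_mul]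
    rw [this]; ring
  rw [hdec]
  have hA : ‖φ (Sg.T t x0 - x0)‖ ≤ ‖φ‖ * (C0 * t) :=
    (φ.le_opNorm _).trans (by gcongr; exact hb t h0 h1)
  calc _ ≤ ‖q‖ * ‖φ (Sg.T t x0 - x0)‖ + ‖φ (Sg.T t (x - q • x0))‖ := by
        rw [← norm_mul]; exact norm_add_le _ _
    _ ≤ (‖φ‖ / ‖φ x0‖ * ‖x‖) * (‖φ‖ * (C0 * t))
        + D * t * ((1 + ‖φ‖ / ‖φ x0‖ * ‖x0‖) * ‖x‖) := by
        refine add_le_add (by gcongr) ((hker t h0 h1 _ hy).trans (by gcongr))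
    _ = _ := by ring

lemma c0_uniform {X : Type*} [NormedAddCommGroup X] [NormedSpace ℂ X]
    (Sg : C0Semigroup X)
    (H : ∀ φ : X →L[ℂ] ℂ, 
    ∃ C : ℝ, ∀ t : ℝ, 0 < t → t ≤ 1 → ∀ x : X, ‖φ (Sg.T t x - x)‖ ≤ C * t * ‖x‖) :
    ∃ C : ℝ, 0 ≤ C ∧ ∀ t : ℝ, 0 < t → t ≤ 1 → ∀ x : X, ‖t⁻¹ • (Sg.T t x - x)‖ ≤ C * ‖x‖ := by
  let ι := {p : ℝ × X // 0 < p.1 ∧ p.1 ≤ 1 ∧ ‖p.2‖ ≤ 1}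
  obtain ⟨C, hC⟩ := banach_steinhaus (𝕜 := ℂ) (𝕜₂ := ℂ) (σ₁₂ := RingHom.id ℂ)
    (E := StrongDual ℂ X) (F := ℂ) (ι := ι)
    (g := fun p => NormedSpace.inclusionInDoubleDual ℂ X
      (((p.1.1⁻¹ : ℝ) : ℂ) • (Sg.T p.1.1 p.1.2 - p.1.2))) (by
    intro φ
    obtain ⟨C, hC⟩ := H φ
    refine ⟨|C|, ?_⟩
    rintro ⟨⟨t, x⟩, h0, h1, hx⟩
    simp only at h0 h1 hx
    rw [NormedSpace.dual_def, map_smul, norm_smul, Complex.norm_real, norm_inv,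
      Real.norm_of_nonneg h0.le, inv_mul_le_iff₀ h0]
    refine (hC t h0 h1 x).trans ?_
    have : C * t ≤ |C| * t := by gcongr; exact le_abs_self C
    have h3 : |C| * t * ‖x‖ ≤ |C| * t * 1 := by gcongr
    have h4 : C * t * ‖x‖ ≤ |C| * t * ‖x‖ := by gcongr
    linarith)
  have hC0 : 0 ≤ C := (norm_nonneg _).trans (hC ⟨(1, 0), by simp⟩)
  have h1 : ∀ t : ℝ, 0 < t → t ≤ 1 → ∀ x : X, ‖x‖ ≤ 1 → ‖Sg.T t x - x‖ ≤ C * t := by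
    intro t h0 h1 x hx
    have h2 : ‖((t⁻¹ : ℝ) : ℂ) • (Sg.T t x - x)‖ ≤ C := by
      refine NormedSpace.norm_le_dual_bound ℂ _ hC0 (fun φ => ?_)
      have h3 := (ContinuousLinearMap.le_opNorm _ φ).trans
        (mul_le_mul_of_nonneg_right (hC ⟨(t, x), h0, h1, hx⟩) (norm_nonneg φ))
      exact h3
    rw [norm_smul, Complex.norm_real, norm_inv,
      Real.norm_of_nonneg h0.le, inv_mul_le_iff₀ h0] at h2
    linarith
  refine ⟨C, hC0, fun t h0 ht1 x => ?_⟩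
  by_cases hx0 : x = 0
  · simp [hx0]
  have hxp : 0 < ‖x‖ := norm_pos_iff.2 hx0
  have h2 := h1 t h0 ht1 (((‖x‖⁻¹ : ℝ) : ℂ) • x)
      (by rw [norm_smul, Complex.norm_real, norm_inv, norm_norm, inv_mul_cancel₀ hxp.ne'])
  rw [map_smul, ← smul_sub, norm_smul, Complex.norm_real, norm_inv, norm_norm,
      inv_mul_le_iff₀ hxp] at h2
  rw [norm_smul, norm_inv, Real.norm_of_nonneg h0.le, inv_mul_le_iff₀ h0]
  linarith

/-- if the generator `A` is unbounded, there is a norm equivalent to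
the original one with respect to which the semigroup is not quasi-contractive. -/
theorem stmt_4 {X : Type*} [NormedAddCommGroup X] [NormedSpace ℂ X] [CompleteSpace X]
    (Sg : C0Semigroup X) (domA : Set X) (A : X → X)
    (hgen : IsGeneratorOf Sg domA A)
    (hunb : ¬ (domA = Set.univ ∧ ∃ C : ℝ, ∀ x : X, ‖A x‖ ≤ C * ‖x‖)) :
    ∃ N : X → ℝ,
      (∀ z w : X, N (z + w) ≤ N z + N w) ∧
      (∀ (c : ℂ) (z : X), N (c • z) = ‖c‖ * N z) ∧
      (∃ c C : ℝ, 0 < c ∧ 0 < C ∧ ∀ z : X, c * ‖z‖ ≤ N z ∧ N z ≤ C * ‖z‖) ∧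
      (∀ lam : ℝ, ∃ t : ℝ, 0 ≤ t ∧ ∃ x : X,
        Real.exp (lam * t) * N x < N (Sg.T t x)) := by
  by_contra hcon
  have H : ∀ N : X → ℝ, (∀ z w : X, N (z + w) ≤ N z + N w) →
      (∀ (c : ℂ) (z : X), N (c • z) = ‖c‖ * N z) →
      (∃ c C : ℝ, 0 < c ∧ 0 < C ∧ ∀ z : X, c * ‖z‖ ≤ N z ∧ N z ≤ C * ‖z‖) →
      ∃ lam : ℝ, ∀ t : ℝ, 0 ≤ t → ∀ x : X, N (Sg.T t x) ≤ Real.exp (lam * t) * N x := by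
    intro N h1 h2 h3
    by_contra h4
    push Not at h4
    exact hcon ⟨N, h1, h2, h3, h4⟩
  obtain ⟨C, hC0, hC⟩ := c0_uniform Sg (c0_functional Sg H)
  have hev : ∀ᶠ t in 𝓝[>] (0:ℝ), 0 < t ∧ t ≤ 1 := by
    filter_upwards [Ioc_mem_nhdsGT (zero_lt_one' ℝ)] with t ht using ht
  have hall : ∀ x : X, x ∈ domA := by
    intro x
    rw [hgen.1]
    apply cauchy_map_iff_exists_tendsto.1
    rw [Metric.cauchy_iff]
    refine ⟨inferInstance, fun ε hε => ?_⟩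
    obtain ⟨y, ⟨z, hz⟩, hxy⟩ := Metric.mem_closure_iff.1 (c0_dense Sg x)
      (ε / (4 * (C + 1))) (by positivity)
    rw [dist_eq_norm, lt_div_iff₀ (by positivity)] at hxy
    have hz' := Metric.tendsto_nhds.1 hz (ε / 4) (by positivity)
    refine ⟨_, image_mem_map (hev.and hz'), ?_⟩
    have key : ∀ t : ℝ, ((0 < t ∧ t ≤ 1) ∧ dist (t⁻¹ • (Sg.T t y - y)) z < ε / 4) →
        dist (t⁻¹ • (Sg.T t x - x)) z < ε / 2 := by
      rintro t ⟨⟨h0, h1⟩, h2⟩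
      have h3 := hC t h0 h1 (x - y)
      have h4 : dist (t⁻¹ • (Sg.T t x - x)) (t⁻¹ • (Sg.T t y - y)) ≤ C * ‖x - y‖ := by
        rw [dist_eq_norm, ← smul_sub]
        have h5 : (Sg.T t x - x) - (Sg.T t y - y) = Sg.T t (x - y) - (x - y) := by
          rw [map_sub]; abel
        rw [h5]; exact h3
      have := dist_triangle (t⁻¹ • (Sg.T t x - x)) (t⁻¹ • (Sg.T t y - y)) z
      nlinarith [norm_nonneg (x - y)]
    rintro _ ⟨s, hs, rfl⟩ _ ⟨t, ht, rfl⟩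
    have := dist_triangle_right (s⁻¹ • (Sg.T s x - x)) (t⁻¹ • (Sg.T t x - x)) z
    have := key s hs
    have := key t ht
    linarith
  refine hunb ⟨Set.eq_univ_of_forall hall, C, fun x => ?_⟩
  refine le_of_tendsto (hgen.2 x (hall x)).norm ?_
  filter_upwards [hev] with t ht using hC t ht.1 ht.2 x
end
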